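/- Let G2 be the graph on vertex set {0, 1, ..., 11} whose edge set consists of the cycle edges {i, (i+1) mod 12} for 0 ≤ i ≤ 11, together with the chords {0,6}, {2,8} and {4,10}. Then G2 admits no linear order of its vertices avoiding the pattern P_{abcd}. Consequently, the class C_{abcd} does not contain all finite simple graphs. -/

import Mathlib

/-- The order given by an injective `f : V → ℝ` avoids the pattern `P_{abcd}`
(edges 13 and 24, non-edges 12, 23, 34 and 14). -/
def AvoidsPabcd {V : Type*} (G : SimpleGraph V) (f : V → ℝ) : Prop :=
  ∀ v1 v2 v3 v4 : V, f v1 < f v2 → f v2 < f v3 → f v3 < f v4 →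
    G.Adj v1 v3 → G.Adj v2 v4 →
    ¬G.Adj v1 v2 → ¬G.Adj v2 v3 → ¬G.Adj v3 v4 → ¬G.Adj v1 v4 → False

/-- The class `C_{abcd}`: graphs admitting a vertex order avoiding `P_{abcd}`. -/
def InCabcd {V : Type*} (G : SimpleGraph V) : Prop :=
  ∃ f : V → ℝ, Function.Injective f ∧ AvoidsPabcd G f

/-- The graph `G2` on vertices `0, …, 11`: the 12-cycle together with the chords
`{0,6}`, `{2,8}` and `{4,10}`. -/
def G2 : SimpleGraph (Fin 12) :=
  SimpleGraph.fromRel (fun i j =>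
    ((i.val + 1) % 12 = j.val) ∨ (i = 0 ∧ j = 6) ∨ (i = 2 ∧ j = 8) ∨ (i = 4 ∧ j = 10))

/-- Adjacency in `G2` is decidable. -/
instance : DecidableRel G2.Adj := by
  unfold G2
  infer_instance

/-- The indicator of `f a < f b`. -/
noncomputable def ltIndicator {V : Type*} (f : V → ℝ) (a b : V) : ℤ :=
  if f a < f b then 1 else 0

theorem ltIndicator_add_swap {V : Type*} {f : V → ℝ} (hf : Function.Injective f) {a b : V}
    (h : a ≠ b) : ltIndicator f a b + ltIndicator f b a = 1 := by
  unfold ltIndicator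
  rcases lt_or_gt_of_ne (hf.ne h) with h | h <;> simp [h, h.le]

/-- In an order avoiding `P_{abcd}`, two edges that induce a `2K₂` do not cross, so that the number
of pairs with first member in one edge and second member in the other that are increasing is even. -/
theorem AvoidsPabcd.even_sum_ltIndicator {V : Type*} {G : SimpleGraph V} {f : V → ℝ}
    (hf : Function.Injective f) (h : AvoidsPabcd G f) (a b c d : V)
    (hedges : G.Adj a b ∧ G.Adj c d ∧ ¬G.Adj a c ∧ ¬G.Adj a d ∧ ¬G.Adj b c ∧ ¬G.Adj b d) :
    Even (ltIndicator f a c + ltIndicator f a d + ltIndicator f b c + ltIndicator f b d) := by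
  obtain ⟨hab, hcd, hac, had, hbc, hbd⟩ := hedges
  have no_cross : ∀ p q r s : V, G.Adj p q → G.Adj r s → ¬G.Adj p r → ¬G.Adj p s → ¬G.Adj q r →
      ¬G.Adj q s → ¬(f p < f r ∧ f r < f q ∧ f q < f s) :=
    fun p q r s hpq hrs hpr hps hqr hqs hlt => h p r q s hlt.1 hlt.2.1 hlt.2.2 hpq hrs hpr
      (fun e => hqr e.symm) hqs hps
  have nac : f a ≠ f c := fun e => hbc (hf e ▸ hab.symm)
  have nad : f a ≠ f d := fun e => hbd (hf e ▸ hab.symm)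
  have nbc : f b ≠ f c := fun e => hac (hf e ▸ hab)
  have nbd : f b ≠ f d := fun e => had (hf e ▸ hab)
  have h₁ := no_cross a b c d hab hcd hac had hbc hbd
  have h₂ := no_cross a b d c hab hcd.symm had hac hbd hbc
  have h₃ := no_cross b a c d hab.symm hcd hbc hbd hac had
  have h₄ := no_cross b a d c hab.symm hcd.symm hbd hbc had hac
  rw [G.adj_comm] at hac had hbc hbd
  have h₅ := no_cross c d a b hcd hab hac hbc had hbd
  have h₆ := no_cross c d b a hcd hab.symm hbc hac hbd had
  have h₇ := no_cross d c a b hcd.symm hab had hbd hac hbc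
  have h₈ := no_cross d c b a hcd.symm hab.symm hbd had hbc hac
  clear no_cross h hab hcd hac had hbc hbd
  unfold ltIndicator
  grind

/-- `G2` is not in `C_{abcd}`; consequently `C_{abcd}` does not contain all
finite simple graphs. -/
theorem G2_not_in_Cabcd :
    ¬InCabcd G2 ∧
    (∃ (V : Type) (_ : Finite V) (G : SimpleGraph V), ¬InCabcd G) := by
  suffices h : ¬InCabcd G2 from ⟨h, Fin 12, inferInstance, G2, h⟩
  rintro ⟨f, hf, h⟩
  have even := h.even_sum_ltIndicator hf
  have swap : ∀ a b : Fin 12, a ≠ b → ltIndicator f a b + ltIndicator f b a = 1 :=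
    fun a b => ltIndicator_add_swap hf
  obtain ⟨k0, hk0⟩ := even 0 1 7 8 (by decide)
  obtain ⟨k1, hk1⟩ := even 0 1 8 9 (by decide)
  obtain ⟨k2, hk2⟩ := even 0 1 9 10 (by decide)
  obtain ⟨k3, hk3⟩ := even 0 1 4 10 (by decide)
  obtain ⟨k4, hk4⟩ := even 1 2 4 5 (by decide)
  obtain ⟨k5, hk5⟩ := even 1 2 5 6 (by decide)
  obtain ⟨k6, hk6⟩ := even 1 2 6 7 (by decide)
  obtain ⟨k7, hk7⟩ := even 2 3 6 7 (by decide)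
  obtain ⟨k8, hk8⟩ := even 2 3 0 6 (by decide)
  obtain ⟨k9, hk9⟩ := even 3 4 6 7 (by decide)
  obtain ⟨k10, hk10⟩ := even 3 4 0 6 (by decide)
  obtain ⟨k11, hk11⟩ := even 4 5 2 8 (by decide)
  obtain ⟨k12, hk12⟩ := even 5 6 2 8 (by decide)
  obtain ⟨k13, hk13⟩ := even 7 8 10 11 (by decide)
  obtain ⟨k14, hk14⟩ := even 7 8 0 11 (by decide)
  obtain ⟨k15, hk15⟩ := even 7 8 4 10 (by decide)
  obtain ⟨k16, hk16⟩ := even 0 6 2 8 (by decide)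
  have s2_0 := swap 2 0 (by decide)
  have s3_0 := swap 3 0 (by decide)
  have s4_0 := swap 4 0 (by decide)
  have s4_2 := swap 4 2 (by decide)
  have s5_2 := swap 5 2 (by decide)
  have s6_2 := swap 6 2 (by decide)
  have s7_0 := swap 7 0 (by decide)
  have s7_4 := swap 7 4 (by decide)
  have s8_0 := swap 8 0 (by decide)
  have s8_4 := swap 8 4 (by decide)
  omega
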